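/- Let a : Fin m → Fin N → (ZMod 2)² satisfy: (a) for every pair i, i' ∈ Fin m the number of anticommuting positions of (a i, a i') is even; (b) for every ε : Fin m → ZMod 2 with ε ≠ 0, the row ∑ i, ε i • a i is not the zero row. Then the state ρ = (2^N : ℂ)⁻¹ • P, where P is the ordered product (1 + G (a 0)) * ⋯ * (1 + G (a (m-1))), has purity trace(ρ * ρ) = 2^m / 2^N. -/

import Mathlib

open Matrix

/-- Pauli matrices indexed by GF(4) identified with (ZMod 2)². -/
noncomputable def pauli (a : ZMod 2 × ZMod 2) : Matrix (Fin 2) (Fin 2) ℂ :=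
  if a = (0, 0) then 1
  else if a = (1, 0) then !![0, 1; 1, 0]
  else if a = (0, 1) then !![0, -Complex.I; Complex.I, 0]
  else !![1, 0; 0, -1]

/-- The N-qubit Pauli word σ_{a 0} ⊗ ⋯ ⊗ σ_{a (N-1)}. -/
noncomputable def pauliWord {N : ℕ} (a : Fin N → ZMod 2 × ZMod 2) :
    Matrix (Fin N → Fin 2) (Fin N → Fin 2) ℂ :=
  Matrix.of fun x y => ∏ i, pauli (a i) (x i) (y i)

/-- The number of anticommuting positions of a pair of rows (a, b). -/
def anticommCount {N : ℕ} (a b : Fin N → ZMod 2 × ZMod 2) : ℕ :=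
  (Finset.univ.filter fun i => ¬(a i = 0 ∨ b i = 0 ∨ a i = b i)).card

lemma pauli_zero_zero : pauli (0, 0) = !![1, 0; 0, 1] := by
  rw [pauli, if_pos rfl, Matrix.one_fin_two]

lemma pauli_one_zero : pauli (1, 0) = !![0, 1; 1, 0] := by
  simp [pauli]

lemma pauli_zero_one : pauli (0, 1) = !![0, -Complex.I; Complex.I, 0] := by
  simp [pauli]

lemma pauli_one_one : pauli (1, 1) = !![1, 0; 0, -1] := by
  simp [pauli]

lemma zmod_two_prod_cases :
    ∀ a : ZMod 2 × ZMod 2, a = (0, 0) ∨ a = (1, 0) ∨ a = (0, 1) ∨ a = (1, 1) := by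
  decide

lemma pauli_mul_self (a : ZMod 2 × ZMod 2) : pauli a * pauli a = 1 := by
  obtain rfl | rfl | rfl | rfl := zmod_two_prod_cases a <;>
    simp [pauli_zero_zero, pauli_one_zero, pauli_zero_one, pauli_one_one, Matrix.one_fin_two]

lemma trace_pauli_of_ne_zero {a : ZMod 2 × ZMod 2} (ha : a ≠ 0) : (pauli a).trace = 0 := by
  obtain rfl | rfl | rfl | rfl := zmod_two_prod_cases a
  · exact absurd rfl ha
  all_goals simp [pauli_one_zero, pauli_zero_one, pauli_one_one, Matrix.trace]

lemma exists_pauli_mul (a b : ZMod 2 × ZMod 2) :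
    ∃ c : ℂ, pauli a * pauli b = c • pauli (a + b) := by
  have key : ∃ c ∈ ({1, Complex.I, -Complex.I} : Set ℂ),
      pauli a * pauli b = c • pauli (a + b) := by
    have two : (1 : ZMod 2) + 1 = 0 := by decide
    obtain rfl | rfl | rfl | rfl := zmod_two_prod_cases a <;>
      obtain rfl | rfl | rfl | rfl := zmod_two_prod_cases b <;>
      simp [two, pauli_zero_zero, pauli_one_zero, pauli_zero_one, pauli_one_one]
  obtain ⟨c, -, hc⟩ := key
  exact ⟨c, hc⟩

lemma pauli_mul_comm_sign (a b : ZMod 2 × ZMod 2) :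
    pauli a * pauli b =
      (if ¬(a = 0 ∨ b = 0 ∨ a = b) then (-1 : ℂ) else 1) • (pauli b * pauli a) := by
  rw [← Prod.mk_zero_zero]
  obtain rfl | rfl | rfl | rfl := zmod_two_prod_cases a <;>
    obtain rfl | rfl | rfl | rfl := zmod_two_prod_cases b <;>
    simp [pauli_zero_zero, pauli_one_zero, pauli_zero_one, pauli_one_one]

section Words

variable {N : ℕ}

lemma pauliWord_mul_apply (a b : Fin N → ZMod 2 × ZMod 2) (x y : Fin N → Fin 2) :
    (pauliWord a * pauliWord b) x y = ∏ i, (pauli (a i) * pauli (b i)) (x i) (y i) := by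
  simp only [Matrix.mul_apply, pauliWord, Matrix.of_apply, ← Finset.prod_mul_distrib]
  rw [Finset.prod_univ_sum, Fintype.piFinset_univ]

lemma prod_one_apply (x y : Fin N → Fin 2) :
    ∏ i, (1 : Matrix (Fin 2) (Fin 2) ℂ) (x i) (y i) =
      (1 : Matrix (Fin N → Fin 2) (Fin N → Fin 2) ℂ) x y := by
  simp only [Matrix.one_apply, Finset.prod_ite_zero, funext_iff, Finset.mem_univ, true_imp_iff,
    Finset.prod_const_one]

lemma pauliWord_mul_self (a : Fin N → ZMod 2 × ZMod 2) : pauliWord a * pauliWord a = 1 := by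
  ext x y
  simp only [pauliWord_mul_apply, pauli_mul_self, prod_one_apply]

lemma exists_pauliWord_mul (a b : Fin N → ZMod 2 × ZMod 2) :
    ∃ c : ℂ, pauliWord a * pauliWord b = c • pauliWord (a + b) := by
  choose c hc using fun i => exists_pauli_mul (a i) (b i)
  refine ⟨∏ i, c i, ?_⟩
  ext x y
  rw [pauliWord_mul_apply]
  simp [hc, pauliWord, Finset.prod_mul_distrib]

lemma pauliWord_commute {a b : Fin N → ZMod 2 × ZMod 2} (h : Even (anticommCount a b)) :
    Commute (pauliWord a) (pauliWord b) := by
  ext x y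
  rw [pauliWord_mul_apply, pauliWord_mul_apply]
  have hsign : ∏ i, (if ¬(a i = 0 ∨ b i = 0 ∨ a i = b i) then (-1 : ℂ) else 1) = 1 := by
    rw [Finset.prod_ite, Finset.prod_const, Finset.prod_const_one, mul_one]
    exact h.neg_one_pow
  simp_rw [fun i => pauli_mul_comm_sign (a i) (b i), Matrix.smul_apply, smul_eq_mul,
    Finset.prod_mul_distrib]
  rw [hsign, one_mul]

lemma trace_pauliWord_of_ne_zero {a : Fin N → ZMod 2 × ZMod 2} (ha : a ≠ 0) :
    (pauliWord a).trace = 0 := by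
  have htrace : (pauliWord a).trace = ∏ i, (pauli (a i)).trace := by
    simp only [Matrix.trace, Matrix.diag_apply, pauliWord, Matrix.of_apply]
    rw [Finset.prod_univ_sum, Fintype.piFinset_univ]
  obtain ⟨i, hi⟩ := Function.ne_iff.mp ha
  rw [htrace]
  exact Finset.prod_eq_zero (Finset.mem_univ i) (trace_pauli_of_ne_zero hi)

lemma trace_pauliWord_mul_prod_eq_zero {m : ℕ} (a : Fin m → Fin N → ZMod 2 × ZMod 2)
    (b : Fin N → ZMod 2 × ZMod 2) (h : ∀ ε : Fin m → ZMod 2, b + ∑ i, ε i • a i ≠ 0) :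
    (pauliWord b * (List.ofFn fun i => 1 + pauliWord (a i)).prod).trace = 0 := by
  induction m generalizing b with
  | zero =>
    have hb : b ≠ 0 := by simpa using h 0
    simpa using trace_pauliWord_of_ne_zero hb
  | succ m ih =>
    obtain ⟨c, hc⟩ := exists_pauliWord_mul b (a 0)
    rw [List.ofFn_succ, List.prod_cons, ← mul_assoc, mul_add, mul_one, hc, add_mul, smul_mul_assoc,
      Matrix.trace_add, Matrix.trace_smul, ih (fun i => a i.succ) b, ih (fun i => a i.succ),
      smul_zero, add_zero]
    · intro ε
      simpa [Fin.sum_univ_succ, add_assoc] using h (Fin.cons 1 ε)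
    · intro ε
      simpa [Fin.sum_univ_succ] using h (Fin.cons 0 ε)

lemma trace_prod_one_add_pauliWord {m : ℕ} (a : Fin m → Fin N → ZMod 2 × ZMod 2)
    (h : ∀ ε : Fin m → ZMod 2, ε ≠ 0 → (∑ i, ε i • a i) ≠ 0) :
    ((List.ofFn fun i => 1 + pauliWord (a i)).prod).trace = 2 ^ N := by
  induction m with
  | zero => simp [Matrix.trace_one]
  | succ m ih =>
    rw [List.ofFn_succ, List.prod_cons, add_mul, one_mul, Matrix.trace_add,
      ih (fun i => a i.succ), trace_pauliWord_mul_prod_eq_zero (fun i => a i.succ), add_zero]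
    · intro ε
      have hne : (Fin.cons 1 ε : Fin (m + 1) → ZMod 2) ≠ 0 := fun h0 => by
        simpa using congrFun h0 0
      simpa [Fin.sum_univ_succ] using h _ hne
    · intro ε hε
      have hne : (Fin.cons 0 ε : Fin (m + 1) → ZMod 2) ≠ 0 := fun h0 =>
        hε (funext fun i => by simpa using congrFun h0 i.succ)
      simpa [Fin.sum_univ_succ] using h _ hne

end Words

lemma List.prod_mul_prod_eq_smul_of_commute {R A : Type*} [CommSemiring R] [Semiring A]
    [Algebra R A] (r : R) (l : List A) (hcomm : ∀ x ∈ l, ∀ y ∈ l, Commute x y)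
    (hsq : ∀ x ∈ l, x * x = r • x) : l.prod * l.prod = r ^ l.length • l.prod := by
  induction l with
  | nil => simp
  | cons x l ih =>
    have hx : Commute l.prod x :=
      Commute.list_prod_left _ _ fun y hy => hcomm y (by simp [hy]) x (by simp)
    have hl := ih (fun y hy z hz => hcomm y (by simp [hy]) z (by simp [hz]))
      (fun y hy => hsq y (by simp [hy]))
    rw [List.prod_cons, hx.mul_mul_mul_comm, hl, hsq x (by simp), smul_mul_smul_comm,
      List.length_cons, pow_succ']

theorem stmt_6 (N m : ℕ) (hN : 1 ≤ N) (hm : 1 ≤ m)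
    (a : Fin m → Fin N → ZMod 2 × ZMod 2)
    (hcomm : ∀ i i' : Fin m, Even (anticommCount (a i) (a i')))
    (hindep : ∀ ε : Fin m → ZMod 2, ε ≠ 0 → (∑ i, ε i • a i) ≠ 0)
    (P : Matrix (Fin N → Fin 2) (Fin N → Fin 2) ℂ)
    (hP : P = (List.ofFn fun i => 1 + pauliWord (a i)).prod)
    (ρ : Matrix (Fin N → Fin 2) (Fin N → Fin 2) ℂ)
    (hρ : ρ = (2 ^ N : ℂ)⁻¹ • P) :
    Matrix.trace (ρ * ρ) = (2 : ℂ) ^ m / 2 ^ N := by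
  have htrace : P.trace = 2 ^ N := hP ▸ trace_prod_one_add_pauliWord a hindep
  have hsq : P * P = (2 : ℂ) ^ m • P := by
    have h := List.prod_mul_prod_eq_smul_of_commute (2 : ℂ)
      (List.ofFn fun i => 1 + pauliWord (a i)) ?_ ?_
    · rwa [List.length_ofFn, ← hP] at h
    · simp only [List.forall_mem_ofFn_iff]
      intro i j
      exact ((Commute.one_left _).add_left
        ((Commute.one_right _).add_right (pauliWord_commute (hcomm i j))))
    · simp only [List.forall_mem_ofFn_iff]
      intro i
      rw [add_mul, mul_add, mul_add, pauliWord_mul_self, one_mul, one_mul, mul_one, two_smul]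
      abel
  rw [hρ, smul_mul_smul_comm, hsq, Matrix.trace_smul, Matrix.trace_smul, htrace]
  have h2 : (2 : ℂ) ^ N ≠ 0 := pow_ne_zero N two_ne_zero
  simp only [smul_eq_mul]
  field_simp
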